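/- Let H = ℓ₂ be the real Hilbert space of square-summable sequences and let X = H ⊕_∞ ℝ. Suppose T : H → H is a bounded linear operator with ‖T‖ = 1 that does not attain its norm, and suppose B : H → H satisfies ‖B‖ = 1 and there is a sequence (y_n) with ‖y_n‖ = 1 and ‖T(B y_n) − y_n‖ → 0. Define T̂ : X → H by T̂(x, a) = T x and B̂ : H → X by B̂(y) = (B y, 0). Then: ‖T̂‖ = 1; T̂ does not attain its norm; there exists a sequence (z_n) in the unit sphere of X with ‖T̂ z_n‖ → ‖T̂‖ that does not converge weakly to 0; ‖B̂‖ = 1; and ‖T̂(B̂ y_n) − y_n‖ → 0. -/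

import Mathlib

open Filter Topology
open scoped ENNReal

/-- A bounded linear operator attains its norm if `‖T x‖ = ‖T‖` for some `x` in the
closed unit ball. -/
def NormAttains {X Y : Type*} [NormedAddCommGroup X] [NormedSpace ℝ X]
    [NormedAddCommGroup Y] [NormedSpace ℝ Y] (T : X →L[ℝ] Y) : Prop :=
  ∃ x : X, ‖x‖ ≤ 1 ∧ ‖T x‖ = ‖T‖

/-- A sequence converges weakly to `0` if `f (x n) → 0` for every continuous linear
functional `f`. -/
def WeaklyNull {X : Type*} [NormedAddCommGroup X] [NormedSpace ℝ X] (x : ℕ → X) : Prop :=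
  ∀ f : X →L[ℝ] ℝ, Tendsto (fun n => f (x n)) atTop (nhds 0)

noncomputable abbrev H : Type := lp (fun _ : ℕ => ℝ) 2

noncomputable abbrev Xinfty : Type := WithLp ∞ (H × ℝ)

theorem V_operator_example
    (T : H →L[ℝ] H) (hTnorm : ‖T‖ = 1) (hT : ¬ NormAttains T)
    (B : H →L[ℝ] H) (hBnorm : ‖B‖ = 1)
    (y : ℕ → H) (hy : ∀ n, ‖y n‖ = 1)
    (hTB : Tendsto (fun n => ‖T (B (y n)) - y n‖) atTop (nhds 0))
    (That : Xinfty →L[ℝ] H)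
    (hThat : ∀ z : Xinfty, That z = T ((WithLp.equiv ∞ (H × ℝ)) z).1)
    (Bhat : H →L[ℝ] Xinfty)
    (hBhat : ∀ v : H, (WithLp.equiv ∞ (H × ℝ)) (Bhat v) = (B v, 0)) :
    ‖That‖ = 1 ∧ ¬ NormAttains That ∧
    (∃ z : ℕ → Xinfty, (∀ n, ‖z n‖ = 1) ∧
      Tendsto (fun n => ‖That (z n)‖) atTop (nhds ‖That‖) ∧ ¬ WeaklyNull z) ∧
    ‖Bhat‖ = 1 ∧
    Tendsto (fun n => ‖That (Bhat (y n)) - y n‖) atTop (nhds 0) := by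
  have norm_eq (z : Xinfty) : ‖z‖ = max ‖z.fst‖ ‖z.snd‖ := WithLp.prod_norm_eq_sup z
  have norm_toLp (x : H) (a : ℝ) : ‖(WithLp.toLp ∞ (x, a) : Xinfty)‖ = max ‖x‖ ‖a‖ := norm_eq _
  have hThat' (z : Xinfty) : That z = T z.fst := hThat z
  have norm_fst_le (z : Xinfty) : ‖z.fst‖ ≤ ‖z‖ := (norm_eq z).symm ▸ le_max_left _ _
  have norm_B_le (n : ℕ) : ‖B (y n)‖ ≤ 1 := by
    simpa [hBnorm, hy n] using B.le_opNorm (y n)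
  have hThat_norm : ‖That‖ = 1 := by
    apply le_antisymm
    · refine That.opNorm_le_bound zero_le_one fun z => ?_
      rw [hThat']
      have h := T.le_opNorm z.fst
      rw [hTnorm] at h
      linarith [norm_fst_le z]
    · rw [← hTnorm]
      refine T.opNorm_le_bound (norm_nonneg _) fun x => ?_
      have h := That.le_opNorm (WithLp.toLp ∞ (x, (0 : ℝ)))
      rwa [hThat', norm_toLp, norm_zero, max_eq_left (norm_nonneg _)] at h
  have norm_Bhat (v : H) : ‖Bhat v‖ = ‖B v‖ := by
    have hfst : (Bhat v).fst = B v := congrArg Prod.fst (hBhat v)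
    have hsnd : (Bhat v).snd = 0 := congrArg Prod.snd (hBhat v)
    rw [norm_eq, hfst, hsnd, norm_zero, max_eq_left (norm_nonneg _)]
  refine ⟨hThat_norm, ?_, ⟨fun n => WithLp.toLp ∞ (B (y n), (1 : ℝ)), fun n => ?_, ?_, ?_⟩, ?_, ?_⟩
  · rintro ⟨z, hz, hzT⟩
    exact hT ⟨z.fst, (norm_fst_le z).trans hz, by rw [← hThat', hzT, hThat_norm, hTnorm]⟩
  · rw [norm_toLp, norm_one]
    exact max_eq_right (norm_B_le n)
  · rw [hThat_norm, tendsto_iff_norm_sub_tendsto_zero]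
    refine squeeze_zero (fun _ => norm_nonneg _) (fun n => ?_) hTB
    rw [hThat', ← hy n]
    exact abs_norm_sub_norm_le _ _
  · intro h
    have h1 := h ((ContinuousLinearMap.snd ℝ H ℝ).comp
      (WithLp.prodContinuousLinearEquiv ∞ ℝ H ℝ : Xinfty →L[ℝ] H × ℝ))
    exact one_ne_zero (tendsto_nhds_unique (tendsto_const_nhds (x := (1 : ℝ))) h1)
  · rw [← hBnorm]
    apply le_antisymm
    · exact Bhat.opNorm_le_bound (norm_nonneg _) fun v => norm_Bhat v ▸ B.le_opNorm v
    · exact B.opNorm_le_bound (norm_nonneg _) fun v => norm_Bhat v ▸ Bhat.le_opNorm v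
  · simpa only [hThat, hBhat] using hTB
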